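/- arXiv:2510.26590 — 2 statements merged into one kernel-verified Lean document; each statement's English description precedes it below -/
import Mathlib

section
/- Let d ≥ 1. Let Ω ⊂ ℝ^d be a bounded connected open set, let U ⊆ Ω be a nonempty open set, let K ⊆ Ω be a compact set, and let K' ⊆ U be a compact set. Then there exist ε > 0, a finite family B of open Euclidean balls of radius ε whose centers lie in closure(Ω) \ U, and a coloring col : B → Fin(100^d), such that: (1) K ⊆ U ∪ ⋃_{B ∈ B} B; (2) every ball of B is disjoint from K', and no ball of B is contained in U; (3) for any two distinct balls B₁, B₂ ∈ B with col(B₁) = col(B₂), there is no ball B₃ ∈ B intersecting both B₁ and B₂ (in particular same-colored balls are pairwise disjoint); (4) for every B₀ ∈ B there exists a finite sequence B₀, B₁, …, B_k of balls in B with B_i ∩ B_{i+1} ≠ ∅ for all 0 ≤ i < k and B_k ∩ U ≠ ∅. -/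
open Metric

open MeasureTheory Module in
/-- Volume bound for packings: pairwise `2r`-separated points in a closed ball of radius `R`. -/
lemma card_mul_pow_le_of_separated {E : Type*} [NormedAddCommGroup E] [NormedSpace ℝ E]
    [FiniteDimensional ℝ E] (s : Finset E) (x : E) {r R : ℝ} (hr : 0 < r) (hR : 0 ≤ R)
    (hs : ∀ c ∈ s, dist c x ≤ R) (h : ∀ c ∈ s, ∀ c' ∈ s, c ≠ c' → r + r ≤ dist c c') :
    (s.card : ℝ) * r ^ finrank ℝ E ≤ (R + r) ^ finrank ℝ E := by
  borelize E
  let μ : Measure E := Measure.addHaar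
  have hRr : 0 < R + r := by positivity
  have disj : (s : Set E).PairwiseDisjoint fun c => ball c r := fun c hc c' hc' hne =>
    ball_disjoint_ball (h c hc c' hc' hne)
  have sub : (⋃ c ∈ s, ball c r) ⊆ ball x (R + r) :=
    Set.iUnion₂_subset fun c hc => ball_subset_ball' (by linarith [hs c hc])
  have vol : (s.card : ENNReal) * ENNReal.ofReal (r ^ finrank ℝ E) * μ (ball 0 1) ≤
      ENNReal.ofReal ((R + r) ^ finrank ℝ E) * μ (ball 0 1) := by
    rw [← μ.addHaar_ball_of_pos x hRr]
    refine le_trans (le_of_eq ?_) (measure_mono sub)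
    rw [measure_biUnion_finset disj fun c _ => measurableSet_ball]
    simp only [μ.addHaar_ball_of_pos _ hr, Finset.sum_const, nsmul_eq_mul, mul_assoc]
  have key := (ENNReal.mul_le_mul_iff_left (measure_ball_pos μ _ zero_lt_one).ne'
    measure_ball_lt_top.ne).1 vol
  simpa [ENNReal.toReal_ofReal (pow_nonneg hr.le _)] using
    ENNReal.toReal_le_of_le_ofReal (pow_nonneg hRr.le _) key

open Classical in
/-- Greedy coloring: a finite graph all of whose degrees are less than `N` is `N`-colorable. -/
lemma Finset.exists_coloring_of_degree_lt {α : Type*} {N : ℕ} [NeZero N] {r : α → α → Prop}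
    (hr : ∀ a b, r a b → r b a) (s : Finset α)
    (hs : ∀ v ∈ s, (s.filter fun w => w ≠ v ∧ r v w).card < N) :
    ∃ col : α → Fin N, ∀ v ∈ s, ∀ w ∈ s, v ≠ w → r v w → col v ≠ col w := by
  induction s using Finset.induction_on with
  | empty => exact ⟨fun _ => 0, by simp⟩
  | insert a s ha ih =>
    obtain ⟨col, hcol⟩ := ih fun v hv => lt_of_le_of_lt
      (Finset.card_le_card (Finset.filter_subset_filter _ (Finset.subset_insert a s)))
      (hs v (Finset.mem_insert_of_mem hv))
    obtain ⟨i, hi⟩ : ∃ i, i ∉ ((insert a s).filter fun w => w ≠ a ∧ r a w).image col := by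
      by_contra! hall
      have hcard := (Finset.card_le_card fun i (_ : i ∈ Finset.univ) => hall i).trans
        Finset.card_image_le
      rw [Finset.card_univ, Fintype.card_fin] at hcard
      exact absurd (hs a (Finset.mem_insert_self a s)) hcard.not_gt
    have free : ∀ w ∈ s, r a w → col w ≠ i := fun w hw haw heq =>
      hi (Finset.mem_image.2 ⟨w, Finset.mem_filter.2 ⟨Finset.mem_insert_of_mem hw,
        ne_of_mem_of_not_mem hw ha, haw⟩, heq⟩)
    refine ⟨Function.update col a i, fun v hv w hw hne hvw => ?_⟩
    rcases Finset.mem_insert.1 hv with rfl | hvs <;> rcases Finset.mem_insert.1 hw with rfl | hws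
    · exact absurd rfl hne
    · simpa [Function.update_of_ne hne.symm] using (free w hws hvw).symm
    · simpa [Function.update_of_ne hne] using free v hvs (hr _ _ hvw)
    · rw [Function.update_of_ne (ne_of_mem_of_not_mem hvs ha),
        Function.update_of_ne (ne_of_mem_of_not_mem hws ha)]
      exact hcol v hvs w hws hne hvw

/-- A compact set has a finite subset that is `ε / 2`-separated and whose `ε`-balls cover it. -/
lemma IsCompact.exists_finset_separated_cover {X : Type*} [PseudoMetricSpace X] {A : Set X}
    (hA : IsCompact A) {ε : ℝ} (hε : 0 < ε) :
    ∃ s : Finset X, (s : Set X) ⊆ A ∧ (∀ v ∈ s, ∀ w ∈ s, v ≠ w → ε / 2 ≤ dist v w) ∧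
      A ⊆ ⋃ v ∈ s, ball v ε := by
  let δ : NNReal := ⟨ε / 4, by positivity⟩
  have hδ : δ ≠ 0 := by
    rw [Ne, ← NNReal.coe_eq_zero]
    exact (show (0 : ℝ) < ε / 4 by positivity).ne'
  have hδε : ((2 * δ : NNReal) : ℝ) = ε / 2 := by
    change 2 * (ε / 4) = ε / 2
    ring
  have hpack : packingNumber (2 * δ) A ≠ ⊤ := by
    obtain ⟨N, hNA, hNfin, hN⟩ := exists_finite_isCover_of_isCompact hδ hA
    exact (((packingNumber_two_mul_le_externalCoveringNumber δ A).trans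
      hN.externalCoveringNumber_le_encard).trans_lt hNfin.encard_lt_top).ne
  have hfin : (maximalSeparatedSet (2 * δ) A).Finite := by
    rw [← Set.encard_ne_top_iff, encard_maximalSeparatedSet hpack]
    exact hpack
  refine ⟨hfin.toFinset, by simpa using maximalSeparatedSet_subset, fun v hv w hw hne => ?_,
    fun x hx => ?_⟩
  · have hlt : ((2 * δ : NNReal) : ENNReal) < edist v w := isSeparated_maximalSeparatedSet
      (hfin.mem_toFinset.1 hv) (hfin.mem_toFinset.1 hw) hne
    rw [edist_nndist] at hlt
    rw [← hδε]
    exact_mod_cast (ENNReal.coe_lt_coe.1 hlt).le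
  · obtain ⟨y, hy, hxy⟩ := Set.mem_iUnion₂.1
      ((isCover_maximalSeparatedSet hpack).subset_iUnion_closedBall hx)
    rw [mem_closedBall, hδε] at hxy
    exact Set.mem_iUnion₂.2 ⟨y, hfin.mem_toFinset.2 hy, mem_ball.2 (by linarith)⟩

/-- `v` is joined to `U` by a chain of consecutively intersecting `ε`-balls centered in `s`. -/
def IsBallChained {X : Type*} [PseudoMetricSpace X] (ε : ℝ) (s U : Set X) (v : X) : Prop :=
  ∃ (k : ℕ) (c : Fin (k + 1) → X), (∀ i, c i ∈ s) ∧ c 0 = v ∧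
    (∀ i : Fin k, (ball (c i.castSucc) ε ∩ ball (c i.succ) ε).Nonempty) ∧
    (ball (c (Fin.last k)) ε ∩ U).Nonempty

namespace IsBallChained

variable {X : Type*} [PseudoMetricSpace X] {ε : ℝ} {s U : Set X} {v w : X}

lemma of_inter (hv : v ∈ s) (h : (ball v ε ∩ U).Nonempty) : IsBallChained ε s U v :=
  ⟨0, fun _ => v, fun _ => hv, rfl, fun i => i.elim0, h⟩

lemma cons (hv : v ∈ s) (h : (ball v ε ∩ ball w ε).Nonempty) (hw : IsBallChained ε s U w) :
    IsBallChained ε s U v := by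
  obtain ⟨k, c, hc, rfl, hstep, hlast⟩ := hw
  refine ⟨k + 1, Fin.cons v c, fun i => ?_, rfl, fun i => ?_, ?_⟩
  · cases i using Fin.cases with
    | zero => exact hv
    | succ i => exact hc i
  · cases i using Fin.cases with
    | zero => exact h
    | succ i => exact hstep i
  · exact hlast

/-- If `U` and the balls cover a preconnected set meeting `U`, then every ball centered in that set
is chained to `U`. -/
lemma of_isPreconnected {A : Set X} (hε : 0 < ε) (hA : IsPreconnected A) (hU : IsOpen U)
    (hAU : (A ∩ U).Nonempty) (hcover : A ⊆ U ∪ ⋃ v ∈ s, ball v ε) (hv : v ∈ s) (hvA : v ∈ A) :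
    IsBallChained ε s U v := by
  by_contra hnot
  let P := U ∪ ⋃ v ∈ {v ∈ s | IsBallChained ε s U v}, ball v ε
  let Q := ⋃ v ∈ {v ∈ s | ¬ IsBallChained ε s U v}, ball v ε
  have hP : IsOpen P := hU.union (isOpen_biUnion fun _ _ => isOpen_ball)
  have hQ : IsOpen Q := isOpen_biUnion fun _ _ => isOpen_ball
  have hPQ : A ⊆ P ∪ Q := fun x hx => by
    rcases hcover hx with hxU | hxs
    · exact .inl (.inl hxU)
    · obtain ⟨w, hw, hxw⟩ := Set.mem_iUnion₂.1 hxs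
      by_cases hc : IsBallChained ε s U w
      · exact .inl (.inr (Set.mem_iUnion₂.2 ⟨w, ⟨hw, hc⟩, hxw⟩))
      · exact .inr (Set.mem_iUnion₂.2 ⟨w, ⟨hw, hc⟩, hxw⟩)
  obtain ⟨x, -, hxP, hxQ⟩ := hA P Q hP hQ hPQ (hAU.mono fun y hy => ⟨hy.1, .inl hy.2⟩)
    ⟨v, hvA, Set.mem_iUnion₂.2 ⟨v, ⟨hv, hnot⟩, mem_ball_self hε⟩⟩
  obtain ⟨w, ⟨hw, hwnot⟩, hxw⟩ := Set.mem_iUnion₂.1 hxQ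
  rcases hxP with hxU | hxP
  · exact hwnot (of_inter hw ⟨x, hxw, hxU⟩)
  · obtain ⟨z, ⟨-, hzc⟩, hxz⟩ := Set.mem_iUnion₂.1 hxP
    exact hwnot (cons hw ⟨x, hxw, hxz⟩ hzc)

end IsBallChained

lemma dist_lt_add_of_ball_inter_nonempty {X : Type*} [PseudoMetricSpace X] {v w : X} {ε : ℝ}
    (h : (ball v ε ∩ ball w ε).Nonempty) : dist v w < ε + ε := by
  by_contra! hle
  exact Set.not_disjoint_iff_nonempty_inter.2 h (ball_disjoint_ball hle)

/-- An `ε / 2`-separated finite set in `ℝ^d` can be colored with `100^d` colors so that distinct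
points of the same color are at distance at least `4 ε`. -/
lemma exists_coloring_of_separated {d : ℕ} (hd : 1 ≤ d) {ε : ℝ} (hε : 0 < ε)
    (s : Finset (EuclideanSpace ℝ (Fin d)))
    (hs : ∀ v ∈ s, ∀ w ∈ s, v ≠ w → ε / 2 ≤ dist v w) :
    ∃ col : EuclideanSpace ℝ (Fin d) → Fin (100 ^ d),
      ∀ v ∈ s, ∀ w ∈ s, v ≠ w → col v = col w → 4 * ε ≤ dist v w := by
  classical
  obtain ⟨col, hcol⟩ := Finset.exists_coloring_of_degree_lt (N := 100 ^ d)
    (r := fun v w => dist v w < 4 * ε) (fun a b h => by rwa [dist_comm]) s fun v hv => by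
      set t := s.filter fun w => w ≠ v ∧ dist v w < 4 * ε
      have hcard := card_mul_pow_le_of_separated t v (r := ε / 4) (R := 4 * ε) (by positivity)
        (by positivity)
        (fun c hc => by rw [dist_comm]; exact (Finset.mem_filter.1 hc).2.2.le)
        (fun c hc c' hc' hne => by
          linarith [hs c (Finset.mem_filter.1 hc).1 c' (Finset.mem_filter.1 hc').1 hne])
      rw [finrank_euclideanSpace_fin, show 4 * ε + ε / 4 = 17 * (ε / 4) by ring, mul_pow] at hcard
      have hle : (t.card : ℝ) ≤ 17 ^ d := le_of_mul_le_mul_right hcard (by positivity)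
      have hlt : t.card < 100 ^ d := calc
        t.card ≤ 17 ^ d := mod_cast hle
        _ < 100 ^ d := Nat.pow_lt_pow_left (by norm_num) (by omega)
      convert hlt
  exact ⟨col, fun v hv w hw hne heq => not_lt.1 fun hlt => hcol v hv w hw hne hlt heq⟩

/-- **Covering by colored balls.** Let `Ω ⊂ ℝ^d` be a bounded connected open set,
`U ⊆ Ω` a nonempty open set, `K ⊆ Ω` compact, and `K' ⊆ U` compact. Then there
exist `ε > 0`, a finite set `s` of centers lying in `closure Ω \ U`, and a
coloring `col` with `100^d` colors, such that: (1) `K ⊆ U ∪ ⋃_{v ∈ s} B(v, ε)`;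
(2) each ball is disjoint from `K'` and not contained in `U`; (3) no ball of the
family intersects two distinct same-colored balls (in particular same-colored
balls are pairwise disjoint); (4) every ball is connected to `U` through a chain
of consecutively intersecting balls of the family. -/
theorem darboux_ball_cover (d : ℕ) (hd : 1 ≤ d)
    (Ω U K K' : Set (EuclideanSpace ℝ (Fin d)))
    (hΩb : Bornology.IsBounded Ω) (hΩconn : IsConnected Ω) (hΩopen : IsOpen Ω)
    (hUopen : IsOpen U) (hUne : U.Nonempty) (hUΩ : U ⊆ Ω)
    (hK : IsCompact K) (hKΩ : K ⊆ Ω)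
    (hK' : IsCompact K') (hK'U : K' ⊆ U) :
    ∃ ε : ℝ, 0 < ε ∧
      ∃ s : Finset (EuclideanSpace ℝ (Fin d)),
        (↑s : Set (EuclideanSpace ℝ (Fin d))) ⊆ closure Ω \ U ∧
        ∃ col : EuclideanSpace ℝ (Fin d) → Fin (100 ^ d),
          (K ⊆ U ∪ ⋃ v ∈ s, ball v ε) ∧
          (∀ v ∈ s, Disjoint (ball v ε) K' ∧ ¬ ball v ε ⊆ U) ∧
          (∀ v ∈ s, ∀ w ∈ s, v ≠ w → col v = col w →
            Disjoint (ball v ε) (ball w ε) ∧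
            ∀ z ∈ s, ¬ ((ball z ε ∩ ball v ε).Nonempty ∧
                        (ball z ε ∩ ball w ε).Nonempty)) ∧
          (∀ v ∈ s, ∃ (k : ℕ) (c : Fin (k + 1) → EuclideanSpace ℝ (Fin d)),
            (∀ i, c i ∈ s) ∧ c 0 = v ∧
            (∀ i : Fin k, (ball (c i.castSucc) ε ∩ ball (c i.succ) ε).Nonempty) ∧
            (ball (c (Fin.last k)) ε ∩ U).Nonempty) := by
  obtain ⟨ε, hε, hεU⟩ := hK'.exists_thickening_subset_open hUopen hK'U
  have hcompact : IsCompact (closure Ω \ U) := hΩb.isCompact_closure.diff hUopen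
  obtain ⟨s, hsub, hsep, hcover⟩ := hcompact.exists_finset_separated_cover hε
  have hcover' : closure Ω ⊆ U ∪ ⋃ v ∈ s, ball v ε := fun x hx =>
    or_iff_not_imp_left.2 fun hxU => hcover ⟨hx, hxU⟩
  obtain ⟨col, hcol⟩ := exists_coloring_of_separated hd hε s hsep
  refine ⟨ε, hε, s, hsub, col, (hKΩ.trans subset_closure).trans hcover', fun v hv => ⟨?_, ?_⟩,
    fun v hv w hw hne heq => ⟨?_, fun z hz => ?_⟩, fun v hv => ?_⟩
  · refine Set.disjoint_left.2 fun x hxv hxK => (hsub hv).2 (hεU ?_)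
    exact mem_thickening_iff.2 ⟨x, hxK, mem_ball'.1 hxv⟩
  · exact fun hball => (hsub hv).2 (hball (mem_ball_self hε))
  · exact ball_disjoint_ball (by linarith [hcol v hv w hw hne heq])
  · rintro ⟨hzv, hzw⟩
    linarith [hcol v hv w hw hne heq, dist_triangle_left v w z,
      dist_lt_add_of_ball_inter_nonempty hzv, dist_lt_add_of_ball_inter_nonempty hzw]
  · exact IsBallChained.of_isPreconnected (s := s) hε hΩconn.closure.isPreconnected hUopen
      (hUne.mono fun x hx => ⟨subset_closure (hUΩ hx), hx⟩) hcover' hv (hsub hv).1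
end

section
/- Let d ≥ 1 and N ≥ 1 an integer, and let G : ℝ × ℝ^d → ℝ be a smooth function with compact support. Let C := sup_{(t,x)} |∂_t G(t,x)|. For 1 ≤ i ≤ N set I_i = [(i−1)/N, i/N] and define g_i : ℝ^d → ℝ by g_i(x) = ∫_{I_i} G(t,x) dt. Then ∑_{i=1}^N sup_{x ∈ ℝ^d} |g_i(x)| ≤ ∫_0^1 (sup_{x ∈ ℝ^d} |G(t,x)|) dt + C/N. -/
open MeasureTheory

/-- The fibrewise supremum of a bounded continuous function is integrable over any interval. -/
lemma intervalIntegrable_iSup_abs {X : Type*} [TopologicalSpace X] {G : ℝ × X → ℝ}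
    (hG : Continuous G) {M : ℝ} (hM : ∀ p, |G p| ≤ M) (a b : ℝ) :
    IntervalIntegrable (fun t => ⨆ x, |G (t, x)|) volume a b := by
  have hbdd : ∀ t, BddAbove (Set.range fun x => |G (t, x)|) := fun t =>
    ⟨M, by rintro _ ⟨x, rfl⟩; exact hM _⟩
  have hlsc : LowerSemicontinuous fun t => ⨆ x, |G (t, x)| :=
    lowerSemicontinuous_ciSup hbdd fun x =>
      (hG.comp (Continuous.prodMk_left x)).abs.lowerSemicontinuous
  refine (intervalIntegrable_const (c := max M 0)).mono_fun'
    hlsc.measurable.aestronglyMeasurable (Filter.Eventually.of_forall fun t => ?_)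
  beta_reduce
  rw [Real.norm_of_nonneg (Real.iSup_nonneg fun x => abs_nonneg _)]
  exact Real.iSup_le (fun x => (hM _).trans (le_max_left _ _)) (le_max_right _ _)

/-- The supremum of the averages of `G` over an interval is at most the average of the suprema. -/
lemma iSup_abs_integral_le_integral_iSup_abs {X : Type*} [TopologicalSpace X] {G : ℝ × X → ℝ}
    (hG : Continuous G) {M : ℝ} (hM : ∀ p, |G p| ≤ M) {a b : ℝ} (hab : a ≤ b) :
    ⨆ x, |∫ t in a..b, G (t, x)| ≤ ∫ t in a..b, ⨆ x, |G (t, x)| := by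
  refine Real.iSup_le (fun x => ?_)
    (intervalIntegral.integral_nonneg hab fun t _ => Real.iSup_nonneg fun x => abs_nonneg _)
  have hx : Continuous fun t => G (t, x) := hG.comp (Continuous.prodMk_left x)
  refine (intervalIntegral.abs_integral_le_integral_abs hab).trans
    (intervalIntegral.integral_mono_on hab (hx.abs.intervalIntegrable a b)
      (intervalIntegrable_iSup_abs hG hM a b) fun t _ => ?_)
  exact le_ciSup (f := fun x => |G (t, x)|) ⟨M, by rintro _ ⟨y, rfl⟩; exact hM _⟩ x

/-- **Autonomous sum bound.** Let `G : ℝ × ℝ^d → ℝ` be smooth with compact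
support, `C = sup |∂_t G|`, and for `1 ≤ i ≤ N` let `g_i(x) = ∫_{I_i} G(t,x) dt`
where `I_i = [(i−1)/N, i/N]`. Then
`∑_{i=1}^N ‖g_i‖_∞ ≤ ∫_0^1 ‖G(t,·)‖_∞ dt + C/N`. -/
theorem autonomous_sum_bound (d : ℕ) (hd : 1 ≤ d) (N : ℕ) (hN : 1 ≤ N)
    (G : ℝ × EuclideanSpace ℝ (Fin d) → ℝ)
    (hG_smooth : ContDiff ℝ (⊤ : ℕ∞) G)
    (hG_supp : HasCompactSupport G)
    (C : ℝ)
    (hC : C = ⨆ p : ℝ × EuclideanSpace ℝ (Fin d), |deriv (fun s => G (s, p.2)) p.1|)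
    (g : Fin N → EuclideanSpace ℝ (Fin d) → ℝ)
    (hg : ∀ (i : Fin N) (x : EuclideanSpace ℝ (Fin d)),
      g i x = ∫ t in Set.Icc ((i : ℝ) / N) (((i : ℝ) + 1) / N), G (t, x)) :
    (∑ i : Fin N, ⨆ x, |g i x|) ≤ (∫ t in Set.Icc (0 : ℝ) 1, ⨆ x, |G (t, x)|) + C / N := by
  have hG : Continuous G := hG_smooth.continuous
  obtain ⟨M, hM⟩ := hG_supp.exists_bound_of_continuous hG
  have hC_nonneg : 0 ≤ C := hC ▸ Real.iSup_nonneg fun p => abs_nonneg _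
  have hN_pos : (0 : ℝ) < N := by exact_mod_cast hN
  have hterm : ∀ i : Fin N, ⨆ x, |g i x| ≤
      ∫ t in ((i : ℕ) : ℝ) / N..((i + 1 : ℕ) : ℝ) / N, ⨆ x, |G (t, x)| := by
    intro i
    have hle : ((i : ℕ) : ℝ) / N ≤ ((i + 1 : ℕ) : ℝ) / N := by gcongr; simp
    have hgi : ∀ x, g i x = ∫ t in ((i : ℕ) : ℝ) / N..((i + 1 : ℕ) : ℝ) / N, G (t, x) := by
      intro x
      rw [hg, intervalIntegral.integral_of_le hle, integral_Icc_eq_integral_Ioc]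
      push_cast
      rfl
    simp only [hgi]
    exact iSup_abs_integral_le_integral_iSup_abs hG hM hle
  have hsum := intervalIntegral.sum_integral_adjacent_intervals (n := N)
    (a := fun k : ℕ => (k : ℝ) / N) fun k _ => intervalIntegrable_iSup_abs hG hM _ _
  rw [Nat.cast_zero, zero_div, div_self hN_pos.ne', ← Fin.sum_univ_eq_sum_range
    (fun k : ℕ => ∫ t in (k : ℝ) / N..((k + 1 : ℕ) : ℝ) / N, ⨆ x, |G (t, x)|)] at hsum
  rw [integral_Icc_eq_integral_Ioc, ← intervalIntegral.integral_of_le zero_le_one, ← hsum]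
  exact (Finset.sum_le_sum fun i _ => hterm i).trans
    (le_add_of_nonneg_right (div_nonneg hC_nonneg hN_pos.le))
end
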